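/- Let k be a perfect field of positive characteristic p and let V = k[[X]] be the ring of formal power series over k (equivalently, a complete DVR of characteristic p with residue field k). Then there does not exist an analytically ramified local Noetherian domain containing k whose normalization is V. -/

import Mathlib

open IsLocalRing

section Defs

variable {F : Type*} [Field F]

/-- The set of fractions `a/b` with `a, b ∈ R`: the quotient field of `R` inside `F`. -/
def fracSet (R : Subring F) : Set F := {x | ∃ a ∈ R, ∃ b ∈ R, b ≠ 0 ∧ x = a / b}

/-- The normalization of `R` (the integral closure of `R` in its quotient field),
as a subset of `F`. -/
def normalizationSet (R : Subring F) : Set F := {x | x ∈ fracSet R ∧ IsIntegral ↥R x}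

/-- `R` has finite normalization if its normalization is a finitely generated `R`-module. -/
def HasFiniteNormalization (R : Subring F) : Prop :=
  ∃ s : Finset F, ↑s ⊆ normalizationSet R ∧
    normalizationSet R ⊆ (Submodule.span ↥R (↑s : Set F) : Set F)

/-- A (quasilocal) domain is stable if every nonzero ideal `I` contains an element `i`
with `I² = iI`. -/
def IsStableRing (R : Subring F) : Prop :=
  ∀ I : Ideal ↥R, I ≠ ⊥ → ∃ i ∈ I, I ^ 2 = Ideal.span {i} * I

/-- A bad stable ring: a one-dimensional quasilocal stable domain without
finite normalization. -/
def IsBadStableRing (R : Subring F) : Prop :=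
  IsLocalRing ↥R ∧ ringKrullDim ↥R = 1 ∧ IsStableRing R ∧ ¬ HasFiniteNormalization R

/-- The maximal ideal of a quasilocal subring of `F`, as a subset of `F`. -/
def maxIdealSet (R : Subring F) [IsLocalRing ↥R] : Set F :=
  Subtype.val '' (maximalIdeal ↥R : Set ↥R)

/-- `U ⊆ V` is an immediate extension: `𝔪_U ⊆ 𝔪_V` and `V = U + 𝔪_U·V`. -/
def IsImmediateExtension (U V : Subring F) [IsLocalRing ↥U] [IsLocalRing ↥V] : Prop :=
  U ≤ V ∧ maxIdealSet U ⊆ maxIdealSet V ∧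
    ∀ v ∈ V, ∃ u ∈ U, v - u ∈ Submodule.span ↥V (maxIdealSet U)

/-- `Ω(R)`: the `V`-submodule of `Ω_{F/Q}` generated by the image of `R` under the
exterior differential `d_{F/Q}`. -/
noncomputable def OmegaOf (V : Subring F) (Q : Subfield F) (R : Subring F) :
    Submodule ↥V (Ω[F⁄↥Q]) :=
  Submodule.span ↥V ((KaehlerDifferential.D ↥Q F) '' (R : Set F))

/-- A full submodule: the quotient is torsion. -/
def IsFullSubmodule {V : Subring F} {M : Type*} [AddCommGroup M] [Module ↥V M]
    (K : Submodule ↥V M) : Prop :=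
  ∀ x : M, ∃ v : ↥V, v ≠ 0 ∧ v • x ∈ K

/-- A local ring is analytically ramified if its completion at the maximal ideal has a
nonzero nilpotent element. -/
def IsAnalyticallyRamified (R : Type*) [CommRing R] [IsLocalRing R] : Prop :=
  ∃ x : AdicCompletion (maximalIdeal R) R, x ≠ 0 ∧ IsNilpotent x

/-- The embedding dimension of a local ring: `dim_{R/M} M/M²`. -/
noncomputable def embDim (R : Type*) [CommRing R] [IsLocalRing R] : Cardinal :=
  Module.rank (ResidueField R) (CotangentSpace R)

/-- `ε_R`: the dimension of `Ω(R)/𝔪_V·Ω(R)` over the residue field `V/𝔪_V`. -/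
noncomputable def epsilonOf (V : Subring F) (Q : Subfield F) (R : Subring F)
    [IsLocalRing ↥V] : Cardinal :=
  Module.rank (↥V ⧸ maximalIdeal ↥V)
    (↥(OmegaOf V Q R) ⧸
      (maximalIdeal ↥V • (⊤ : Submodule ↥V ↥(OmegaOf V Q R))))

end Defs

open scoped Pointwise

theorem length_quotient_smul_top_eq_ord {R M : Type*} [CommRing R] [IsDomain R]
    [IsNoetherianRing R] [Ring.KrullDimLE 1 R] [AddCommGroup M] [Module R M]
    (f : M →ₗ[R] R) (hf : Function.Injective f) (hf0 : f ≠ 0) {a : R} (ha : a ≠ 0) :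
    Module.length R (M ⧸ (a • ⊤ : Submodule R M)) = Ring.ord R a := by
  set A : Ideal R := LinearMap.range f with hA
  have hA0 : A ≠ ⊥ := fun h => hf0 (LinearMap.range_eq_bot.mp h)
  have hle : (a • ⊤ : Submodule R M) ≤ Submodule.comap f (a • A) := by
    intro x hx
    obtain ⟨y, -, rfl⟩ := (Submodule.mem_smul_pointwise_iff_exists _ _ _).mp hx
    exact (Submodule.mem_smul_pointwise_iff_exists _ _ _).mpr ⟨f y, ⟨y, rfl⟩, by simp⟩
  have haA : a • A ≤ A := by
    rintro x hx
    obtain ⟨y, hy, rfl⟩ := (Submodule.mem_smul_pointwise_iff_exists _ _ _).mp hx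
    exact A.smul_mem a hy
  have h1 := Module.length_eq_add_of_exact (Submodule.mapQ (a • ⊤) (a • A) f hle)
    (Submodule.factor haA)
    (by
      rw [← LinearMap.ker_eq_bot, LinearMap.ker_eq_bot']
      intro m hm
      obtain ⟨x, rfl⟩ := Submodule.Quotient.mk_surjective _ m
      rw [Submodule.mapQ_apply, Submodule.Quotient.mk_eq_zero] at hm
      obtain ⟨_, ⟨y, rfl⟩, hy⟩ := (Submodule.mem_smul_pointwise_iff_exists _ _ _).mp hm
      rw [Submodule.Quotient.mk_eq_zero]
      refine (Submodule.mem_smul_pointwise_iff_exists _ _ _).mpr ⟨y, trivial, hf ?_⟩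
      rw [map_smul, hy])
    (Submodule.factor_surjective haA)
    (by
      intro z
      obtain ⟨x, rfl⟩ := Submodule.Quotient.mk_surjective _ z
      constructor
      · intro h
        obtain ⟨y, rfl⟩ := (Submodule.Quotient.mk_eq_zero A).mp h
        exact ⟨Submodule.Quotient.mk y, rfl⟩
      · rintro ⟨m, hm⟩
        obtain ⟨y, rfl⟩ := Submodule.Quotient.mk_surjective _ m
        rw [← hm]
        exact (Submodule.Quotient.mk_eq_zero _).mpr ⟨y, rfl⟩)
  have h2 := Module.length_eq_add_of_exact (Ideal.mulQuot a A) (Ideal.quotOfMul a A)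
    (Ideal.mulQuot_injective A (mem_nonZeroDivisors_of_ne_zero ha))
    (Ideal.quotOfMul_surjective A) (Ideal.exact_mulQuot_quotOfMul A)
  obtain ⟨x, hxA, hx0⟩ := Submodule.exists_mem_ne_zero_of_ne_bot hA0
  have hfin : Module.length R (R ⧸ A) ≠ ⊤ := by
    have hle' : Ideal.span {x} ≤ A := (Ideal.span_singleton_le_iff_mem A).mpr hxA
    exact ne_top_of_le_ne_top (Ring.ord_ne_top (mem_nonZeroDivisors_of_ne_zero hx0))
      (Module.length_le_of_surjective (Submodule.factor hle') (Submodule.factor_surjective hle'))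
  rw [h1, add_comm] at h2
  exact (ENat.add_right_injective_of_ne_top hfin) h2

theorem pow_mem_span_pow_lt_of_length_le {R S : Type*} [CommRing R] [IsLocalRing R] [CommRing S]
    [Algebra R S] [Module.Finite R S] {v : S} (hv : Algebra.adjoin R {v} = ⊤) {a : R}
    (ha : a ∈ maximalIdeal R) {c : ℕ}
    (hc : Module.length R (S ⧸ (a • ⊤ : Submodule R S)) ≤ c) :
    v ^ c ∈ Submodule.span R ((v ^ ·) '' Set.Iio c) := by
  set N : ℕ → Submodule R S := fun i => Submodule.span R ((v ^ ·) '' Set.Iio i) with hN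
  have hmono : Monotone N := fun i j hij =>
    Submodule.span_mono (Set.image_mono (Set.Iio_subset_Iio hij))
  set T : Submodule R S := a • ⊤ with hT
  have hTv : ∀ x ∈ T, v * x ∈ T := by
    intro x hx
    obtain ⟨y, -, rfl⟩ := (Submodule.mem_smul_pointwise_iff_exists _ _ _).mp hx
    exact (Submodule.mem_smul_pointwise_iff_exists _ _ _).mpr ⟨v * y, trivial, by simp⟩
  have key : ∀ i ≤ c, N (i + 1) ≤ N i ⊔ T → v ^ c ∈ N c := by
    intro i hi h
    have hstep : ∀ x ∈ N i ⊔ T, v * x ∈ N i ⊔ T := by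
      have hmap : (N i ⊔ T).map (LinearMap.mulLeft R v) ≤ N i ⊔ T := by
        rw [Submodule.map_sup]
        refine sup_le ?_ ?_
        · rw [hN, Submodule.map_span, Submodule.span_le]
          rintro _ ⟨_, ⟨j, hj, rfl⟩, rfl⟩
          refine h (Submodule.subset_span ⟨j + 1, Nat.succ_lt_succ hj, ?_⟩)
          simp [pow_succ']
        · rintro _ ⟨x, hx, rfl⟩
          exact Submodule.mem_sup_right (hTv x hx)
      exact fun x hx => hmap ⟨x, hx, rfl⟩
    have hpow : ∀ n, v ^ n ∈ N i ⊔ T := by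
      intro n
      induction n with
      | zero => exact h (Submodule.subset_span ⟨0, Nat.succ_pos i, rfl⟩)
      | succ n ih => rw [pow_succ']; exact hstep _ ih
    have htop : (⊤ : Submodule R S) ≤ N i ⊔ T := by
      rw [← Algebra.top_toSubmodule, ← hv, Algebra.adjoin_singleton_eq_range_aeval]
      rintro _ ⟨P, rfl⟩
      simp only [AlgHom.toRingHom_eq_coe, RingHom.coe_coe, Polynomial.aeval_eq_sum_range]
      exact Submodule.sum_mem _ fun j _ => Submodule.smul_mem _ _ (hpow j)
    have hNak : (⊤ : Submodule R S) ≤ N i := by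
      refine Submodule.le_of_le_smul_of_le_jacobson_bot (I := Ideal.span {a})
        Module.Finite.fg_top ?_ ?_
      · rw [IsLocalRing.jacobson_eq_maximalIdeal ⊥ bot_ne_top]
        exact (Ideal.span_singleton_le_iff_mem _).mpr ha
      · rwa [Submodule.ideal_span_singleton_smul]
    exact hmono hi (hNak trivial)
  by_contra hcon
  have hlt : ∀ i ≤ c, (N i).map T.mkQ < (N (i + 1)).map T.mkQ := by
    intro i hi
    refine lt_of_le_of_ne (Submodule.map_mono (hmono i.le_succ)) fun heq => hcon (key i hi ?_)
    have := congrArg (Submodule.comap T.mkQ) heq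
    rw [Submodule.comap_map_mkQ, Submodule.comap_map_mkQ, sup_comm, sup_comm T] at this
    rw [this]
    exact le_sup_left
  let s : LTSeries (Submodule R (S ⧸ T)) :=
    { length := c + 1
      toFun := fun i => (N i).map T.mkQ
      step := fun i => by simpa using hlt i (Nat.lt_succ_iff.mp i.2) }
  have hs := Order.LTSeries.length_le_krullDim s
  rw [← Module.coe_length R] at hs
  have : (((c + 1 : ℕ) : ℕ∞) : WithBot ℕ∞) ≤ ((c : ℕ∞) : WithBot ℕ∞) :=
    le_trans (by exact_mod_cast hs) (WithBot.coe_le_coe.mpr hc)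
  have := WithBot.coe_le_coe.mp this
  have := Nat.cast_le.mp this
  omega

theorem krullDimLE_one_of_isIntegral (R : Type*) {S : Type*} [CommRing R] [IsDomain R]
    [CommRing S] [IsDomain S] [Algebra R S] [FaithfulSMul R S] [Algebra.IsIntegral R S]
    [Ring.KrullDimLE 1 S] : Ring.KrullDimLE 1 R := by
  rw [Ring.krullDimLE_one_iff_of_noZeroDivisors]
  intro P hP hPp
  have hker : RingHom.ker (algebraMap R S) ≤ P := by
    rw [(RingHom.injective_iff_ker_eq_bot _).mp (FaithfulSMul.algebraMap_injective R S)]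
    exact bot_le
  obtain ⟨Q, hQ, rfl⟩ := Ideal.exists_ideal_over_prime_of_isIntegral_of_isDomain P hker
  have hQ0 : Q ≠ ⊥ := by
    rintro rfl
    apply hP
    rw [← RingHom.ker_eq_comap_bot]
    exact (RingHom.injective_iff_ker_eq_bot _).mp (FaithfulSMul.algebraMap_injective R S)
  have : Q.IsMaximal := hQ.isMaximal_of_ne_bot hQ0
  exact Ideal.isMaximal_comap_of_isIntegral_of_isMaximal Q

theorem exists_common_denominator {R V : Type*} [CommRing R] [IsDomain R] [CommRing V]
    [Algebra R V]
    (hfrac : ∀ v : V, ∃ b : R, b ≠ 0 ∧ algebraMap R V b * v ∈ (algebraMap R V).range)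
    {S : Submodule R V} (hS : S.FG) :
    ∃ b : R, b ≠ 0 ∧ ∀ v ∈ S, algebraMap R V b * v ∈ (algebraMap R V).range := by
  induction S, hS using Submodule.fg_induction with
  | singleton x =>
    obtain ⟨b, hb, hbx⟩ := hfrac x
    refine ⟨b, hb, fun v hv => ?_⟩
    obtain ⟨r, rfl⟩ := Submodule.mem_span_singleton.mp hv
    rw [Algebra.smul_def, mul_left_comm]
    exact mul_mem ⟨r, rfl⟩ hbx
  | sup M₁ M₂ _ _ h₁ h₂ =>
    obtain ⟨b₁, hb₁, h₁⟩ := h₁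
    obtain ⟨b₂, hb₂, h₂⟩ := h₂
    refine ⟨b₁ * b₂, mul_ne_zero hb₁ hb₂, fun v hv => ?_⟩
    obtain ⟨x, hx, y, hy, rfl⟩ := Submodule.mem_sup.mp hv
    have : algebraMap R V (b₁ * b₂) * (x + y) = algebraMap R V b₂ * (algebraMap R V b₁ * x) +
        algebraMap R V b₁ * (algebraMap R V b₂ * y) := by
      rw [map_mul]; ring
    rw [this]
    exact add_mem (mul_mem ⟨b₂, rfl⟩ (h₁ x hx)) (mul_mem ⟨b₁, rfl⟩ (h₂ y hy))

theorem pow_mem_span_pow_lt_of_ord_le {R V : Type*} [CommRing R] [IsDomain R] [IsLocalRing R]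
    [IsNoetherianRing R] [Ring.KrullDimLE 1 R] [CommRing V] [IsDomain V] [Algebra R V]
    [FaithfulSMul R V]
    (hfrac : ∀ v : V, ∃ b : R, b ≠ 0 ∧ algebraMap R V b * v ∈ (algebraMap R V).range)
    {t : R} (ht : t ∈ maximalIdeal R) (ht0 : t ≠ 0) {c : ℕ} (hc : Ring.ord R t ≤ c)
    {v : V} (hv : IsIntegral R v) :
    v ^ c ∈ Submodule.span R ((v ^ ·) '' Set.Iio c) := by
  have hinj := FaithfulSMul.algebraMap_injective R V
  have hfg := hv.fg_adjoin_singleton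
  have : Module.Finite R (Algebra.adjoin R {v}) := Module.Finite.iff_fg.mpr hfg
  obtain ⟨b, hb, hbS⟩ := exists_common_denominator hfrac hfg
  choose g hg using hbS
  let f : Algebra.adjoin R {v} →ₗ[R] R :=
    { toFun := fun x => g x x.2
      map_add' := fun x y => hinj (by rw [map_add, hg, hg, hg]; push_cast; ring)
      map_smul' := fun r x => hinj (by
        rw [RingHom.id_apply, smul_eq_mul, map_mul, hg, hg, Subalgebra.coe_smul,
          Algebra.smul_def]
        ring) }
  have hfspec : ∀ x, algebraMap R V (f x) = algebraMap R V b * x := fun x => hg x x.2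
  have hb' : algebraMap R V b ≠ 0 := fun h => hb (hinj (by rw [h, map_zero]))
  have hfinj : Function.Injective f := fun x y hxy => by
    apply Subtype.ext
    apply mul_left_cancel₀ hb'
    rw [← hfspec, ← hfspec, hxy]
  have hf0 : f ≠ 0 := fun h => by
    have := hfspec 1
    rw [h] at this
    exact hb' (by simpa using this.symm)
  let v' : Algebra.adjoin R {v} := ⟨v, Algebra.self_mem_adjoin_singleton R v⟩
  have hv' : Algebra.adjoin R {v'} = ⊤ := by
    have := Algebra.adjoin_adjoin_coe_preimage (R := R) (s := {v})
    convert this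
    ext x
    simp [v', Subtype.ext_iff]
  have hmem := pow_mem_span_pow_lt_of_length_le hv' ht
    ((length_quotient_smul_top_eq_ord f hfinj hf0 ht0).trans_le hc)
  have := Submodule.mem_map_of_mem (f := (Algebra.adjoin R {v}).val.toLinearMap) hmem
  rw [Submodule.map_span, Set.image_image] at this
  simpa [v'] using this

namespace PowerSeries

variable {k : Type*} [Field k]

theorem pow_expChar_pow_eq (p : ℕ) [ExpChar k p] (e : ℕ) (f : k⟦X⟧) :
    f ^ p ^ e = map (iterateFrobenius k p e)
      (expand (p ^ e) (pow_ne_zero e (expChar_ne_zero k p)) f) := by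
  exact (MvPowerSeries.map_iterateFrobenius_expand p (expChar_ne_zero k p) f e).symm

theorem exists_eq_sum_X_pow_mul_pow (p : ℕ) [ExpChar k p] [PerfectRing k p] (e : ℕ)
    (v : k⟦X⟧) :
    ∃ g : ℕ → k⟦X⟧, v = ∑ i ∈ Finset.range (p ^ e), X ^ i * g i ^ p ^ e := by
  have hp : p ≠ 0 := expChar_ne_zero k p
  have hq : p ^ e ≠ 0 := pow_ne_zero e hp
  refine ⟨fun i => mk fun m => (iterateFrobeniusEquiv k p e).symm (coeff (p ^ e * m + i) v), ?_⟩
  ext n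
  rw [map_sum, Finset.sum_eq_single (n % p ^ e)]
  · rw [pow_expChar_pow_eq, coeff_X_pow_mul', if_pos (Nat.mod_le _ _), coeff_map]
    have hn : n - n % p ^ e = p ^ e * (n / p ^ e) := by
      have := Nat.div_add_mod n (p ^ e)
      omega
    rw [hn, coeff_expand_mul, coeff_mk, Nat.div_add_mod]
    exact ((iterateFrobeniusEquiv k p e).apply_symm_apply _).symm
  · intro i hi hne
    rw [coeff_X_pow_mul']
    split_ifs with hin
    · rw [pow_expChar_pow_eq, coeff_map, coeff_expand_of_not_dvd, map_zero]
      rintro hdvd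
      apply hne
      have := (Nat.modEq_iff_dvd' hin).mpr hdvd
      rw [← Nat.mod_eq_of_lt (Finset.mem_range.mp hi)]
      exact this
    · rfl
  · intro h
    exact absurd (Finset.mem_range.mpr (Nat.mod_lt _ (Nat.pos_of_ne_zero hq))) h

theorem exists_sub_coe_polynomial_eq_mul {b : k⟦X⟧} (hb : b ≠ 0) (v : k⟦X⟧) :
    ∃ (P : Polynomial k) (w : k⟦X⟧), v - P = b * w := by
  set n := b.order.toNat
  obtain ⟨u, hu⟩ := isUnit_divided_by_X_pow_order hb
  refine ⟨trunc n v, ↑u⁻¹ * mk fun i => coeff (i + n) v, ?_⟩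
  have h1 := eq_X_pow_mul_shift_add_trunc n v
  have h2 : X ^ n * (u : k⟦X⟧) = b := by rw [hu]; exact X_pow_order_mul_divXPowOrder
  rw [← h2]
  rw [sub_eq_iff_eq_add, mul_assoc, Units.mul_inv_cancel_left]
  exact h1

theorem coe_polynomial_mem_adjoin_X {R : Type*} [CommRing R] [Algebra R k⟦X⟧]
    (hk : ∀ a : k, C a ∈ (algebraMap R k⟦X⟧).range) (P : Polynomial k) :
    (P : k⟦X⟧) ∈ Algebra.adjoin R {(X : k⟦X⟧)} := by
  induction P using Polynomial.induction_on' with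
  | add P Q hP hQ => rw [Polynomial.coe_add]; exact add_mem hP hQ
  | monomial n a =>
    rw [Polynomial.coe_monomial, monomial_eq_C_mul_X_pow]
    obtain ⟨r, hr⟩ := hk a
    rw [← hr]
    exact mul_mem (Subalgebra.algebraMap_mem _ r)
      (pow_mem (Algebra.self_mem_adjoin_singleton R _) n)

variable {R : Type*} [CommRing R] [IsDomain R] [Algebra R k⟦X⟧] [FaithfulSMul R k⟦X⟧]
  [Algebra.IsIntegral R k⟦X⟧]

theorem exists_conductor_ne_zero (p : ℕ) [hpp : Fact p.Prime] [CharP k p] [ExpChar k p]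
    [PerfectRing k p] [IsLocalRing R] [IsNoetherianRing R]
    (hk : ∀ a : k, C a ∈ (algebraMap R k⟦X⟧).range)
    (hfrac : ∀ v : k⟦X⟧, ∃ b : R, b ≠ 0 ∧
      algebraMap R k⟦X⟧ b * v ∈ (algebraMap R k⟦X⟧).range)
    {t : R} (ht : t ∈ maximalIdeal R) (ht0 : t ≠ 0) :
    ∃ b : R, b ≠ 0 ∧ ∀ v : k⟦X⟧, algebraMap R k⟦X⟧ b * v ∈ (algebraMap R k⟦X⟧).range := by
  have hinj := FaithfulSMul.algebraMap_injective R k⟦X⟧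
  have : Ring.KrullDimLE 1 R := krullDimLE_one_of_isIntegral R (S := k⟦X⟧)
  have : ExpChar k⟦X⟧ p := expChar_of_injective_ringHom (C_injective (R := k)) p
  obtain ⟨c, hc⟩ := ENat.ne_top_iff_exists.mp
    (Ring.ord_ne_top (mem_nonZeroDivisors_of_ne_zero ht0))
  have hcq : c ≤ p ^ c := (Nat.lt_pow_self hpp.out.one_lt).le
  set W := Algebra.adjoin R {(X : k⟦X⟧)} with hW
  have hpow : ∀ v : k⟦X⟧, v ^ p ^ c ∈ W := by
    intro v
    set S := Algebra.adjoin R {v, (X : k⟦X⟧)} with hS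
    have hWS : W ≤ S := Algebra.adjoin_mono (by simp)
    have hSfg : S.toSubmodule.FG := fg_adjoin_of_finite (by simp)
      fun x _ => Algebra.IsIntegral.isIntegral x
    obtain ⟨b, hb, hbS⟩ := exists_common_denominator hfrac hSfg
    set β := algebraMap R k⟦X⟧ b with hβ
    have hβ0 : β ≠ 0 := fun h => hb (hinj (by rw [← hβ, h, map_zero]))
    obtain ⟨P, w, hw⟩ := exists_sub_coe_polynomial_eq_mul hβ0 v
    have hPW := coe_polynomial_mem_adjoin_X hk P
    have huS : β * w ∈ S := by
      rw [← hw]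
      exact sub_mem (Algebra.subset_adjoin (by simp)) (hWS hPW)
    have hspan : ∀ y ∈ Submodule.span R ((w ^ ·) '' Set.Iio c), ∃ z ∈ S, β ^ c * y = β * z := by
      intro y hy
      induction hy using Submodule.span_induction with
      | mem y hy =>
        obtain ⟨j, hj, rfl⟩ := hy
        obtain ⟨d, rfl⟩ := Nat.exists_eq_add_of_lt (Set.mem_Iio.mp hj)
        exact ⟨β ^ d * (β * w) ^ j,
          mul_mem (pow_mem (Subalgebra.algebraMap_mem _ b) d) (pow_mem huS j), by ring⟩
      | zero => exact ⟨0, zero_mem _, by simp⟩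
      | add y₁ y₂ _ _ h₁ h₂ =>
        obtain ⟨z₁, hz₁, h₁⟩ := h₁
        obtain ⟨z₂, hz₂, h₂⟩ := h₂
        exact ⟨z₁ + z₂, add_mem hz₁ hz₂, by rw [mul_add, h₁, h₂, mul_add]⟩
      | smul r y _ h =>
        obtain ⟨z, hz, h⟩ := h
        exact ⟨r • z, Subalgebra.smul_mem _ hz r, by rw [mul_smul_comm, h, mul_smul_comm]⟩
    obtain ⟨z, hz, hz'⟩ := hspan _ (pow_mem_span_pow_lt_of_ord_le hfrac ht ht0 hc.ge
      (Algebra.IsIntegral.isIntegral w))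
    have hu : (v - P) ^ p ^ c ∈ W := by
      obtain ⟨r, hr⟩ := hbS (z * (β * w) ^ (p ^ c - c)) (S.mul_mem hz (pow_mem huS _))
      have : (v - P) ^ p ^ c = algebraMap R k⟦X⟧ r := by
        rw [hr, hw, ← mul_assoc, ← hz', ← mul_pow, ← pow_add, Nat.add_sub_cancel' hcq]
      rw [this]
      exact Subalgebra.algebraMap_mem _ r
    rw [← sub_add_cancel v (P : k⟦X⟧), add_pow_expChar_pow]
    exact add_mem hu (pow_mem hPW _)
  obtain ⟨b, hb, hbW⟩ := exists_common_denominator hfrac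
    (Algebra.IsIntegral.isIntegral (R := R) (X : k⟦X⟧)).fg_adjoin_singleton
  refine ⟨b, hb, fun v => hbW v ?_⟩
  obtain ⟨g, hg⟩ := exists_eq_sum_X_pow_mul_pow p c v
  rw [hg]
  exact sum_mem fun i _ => W.mul_mem (pow_mem (Algebra.self_mem_adjoin_singleton R _) i) (hpow _)

theorem not_isAnalyticallyRamified_of_conductor_ne_zero [IsLocalRing R]
    {b : R} (hb : b ≠ 0)
    (hbV : ∀ v : k⟦X⟧, algebraMap R k⟦X⟧ b * v ∈ (algebraMap R k⟦X⟧).range)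
    {t : R} (ht : t ∈ maximalIdeal R) (ht0 : t ≠ 0) : ¬ IsAnalyticallyRamified R := by
  have hinj := FaithfulSMul.algebraMap_injective R k⟦X⟧
  have hX : ∀ m ∈ maximalIdeal R, X ∣ algebraMap R k⟦X⟧ m := by
    intro m hm
    rw [X_dvd_iff]
    by_contra h
    exact hm ((isUnit_map_iff (algebraMap R k⟦X⟧) m).mp
      (isUnit_iff_constantCoeff.mpr (isUnit_iff_ne_zero.mpr h)))
  have hXpow : ∀ j, ∀ m ∈ maximalIdeal R ^ j, X ^ j ∣ algebraMap R k⟦X⟧ m := by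
    intro j m hm
    have := Ideal.mem_map_of_mem (algebraMap R k⟦X⟧) hm
    rw [Ideal.map_pow] at this
    have hle : (maximalIdeal R).map (algebraMap R k⟦X⟧) ≤ Ideal.span {X} :=
      Ideal.map_le_iff_le_comap.mpr fun m hm => Ideal.mem_span_singleton.mpr (hX m hm)
    have := Ideal.pow_right_mono hle j this
    rwa [Ideal.span_singleton_pow, Ideal.mem_span_singleton] at this
  have hopen : ∀ m, ∃ N, ∀ r : R, X ^ N ∣ algebraMap R k⟦X⟧ r → r ∈ maximalIdeal R ^ m := by
    intro m
    set s := t ^ m * b with hs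
    have hs0 : algebraMap R k⟦X⟧ s ≠ 0 := fun h =>
      mul_ne_zero (pow_ne_zero m ht0) hb (hinj (by rw [← hs, h, map_zero]))
    obtain ⟨u, hu⟩ := isUnit_divided_by_X_pow_order hs0
    refine ⟨(algebraMap R k⟦X⟧ s).order.toNat, fun r hr => ?_⟩
    have h2 : X ^ (algebraMap R k⟦X⟧ s).order.toNat * (u : k⟦X⟧) = algebraMap R k⟦X⟧ s := by
      rw [hu]; exact X_pow_order_mul_divXPowOrder
    obtain ⟨w, hw⟩ := hr
    obtain ⟨a, ha⟩ := hbV (↑u⁻¹ * w)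
    have : r = t ^ m * a := by
      apply hinj
      rw [map_mul, ha, ← mul_assoc, ← map_mul, ← hs, ← h2, mul_assoc,
        Units.mul_inv_cancel_left, hw]
    rw [this]
    exact Ideal.mul_mem_right _ _ (Ideal.pow_mem_pow ht m)
  rintro ⟨x, hx0, n, hxn⟩
  replace hxn : x ^ (n + 1) = 0 := by rw [pow_succ, hxn, zero_mul]
  apply hx0
  obtain ⟨f, rfl⟩ := AdicCompletion.mk_surjective _ _ x
  have hfn : ∀ j, f j ^ (n + 1) ∈ maximalIdeal R ^ j := by
    intro j
    have := congrArg (AdicCompletion.evalₐ (maximalIdeal R) j) hxn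
    rw [map_pow, map_zero, AdicCompletion.evalₐ_mk, ← map_pow, Ideal.Quotient.eq_zero_iff_mem]
      at this
    exact this
  refine AdicCompletion.mk_zero_of _ _ _ ⟨0, fun m _ => ?_⟩
  obtain ⟨N, hN⟩ := hopen m
  refine ⟨m + (n + 1) * N, Nat.le_add_right _ _, m, le_rfl, ?_⟩
  rw [smul_eq_mul, Ideal.mul_top]
  apply hN
  have h := hXpow _ _ (hfn (m + (n + 1) * N))
  have h := (pow_dvd_pow X (Nat.le_add_left ((n + 1) * N) m)).trans h
  rw [map_pow, pow_mul'] at h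
  exact (UniqueFactorizationMonoid.pow_dvd_pow_iff_dvd n.succ_ne_zero).mp h

end PowerSeries

/-- Let `k` be a perfect field of positive characteristic `p` and `V = k[[X]]` (viewed inside
`F = k((X))`).  There is no analytically ramified local Noetherian domain containing `k`
whose normalization is `V`. -/
theorem stmt_16 (k : Type*) [Field k] (p : ℕ) (hp : p.Prime) [CharP k p]
    [ExpChar k p] [PerfectRing k p] :
    ¬ ∃ R : Subring (LaurentSeries k),
        Set.range (algebraMap k (LaurentSeries k)) ⊆ (R : Set (LaurentSeries k)) ∧
        ∃ _ : IsLocalRing ↥R, IsNoetherianRing ↥R ∧ IsAnalyticallyRamified ↥R ∧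
          normalizationSet R =
            ((HahnSeries.ofPowerSeries ℤ k).range : Set (LaurentSeries k)) := by
  rintro ⟨R, hkR, hloc, hnoeth, hram, hnorm⟩
  have : Fact p.Prime := ⟨hp⟩
  set ι := HahnSeries.ofPowerSeries ℤ k with hι
  have hιinj : Function.Injective ι := HahnSeries.ofPowerSeries_injective
  have hRV : ∀ r : R, ∃ f, ι f = (r : LaurentSeries k) := by
    intro r
    have h : (r : LaurentSeries k) ∈ normalizationSet R :=
      ⟨⟨r, r.2, 1, one_mem R, one_ne_zero, (div_one _).symm⟩,
        isIntegral_algebraMap (R := R) (x := r)⟩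
    rw [hnorm] at h
    exact h
  choose g hg using hRV
  let φ : R →+* PowerSeries k :=
    { toFun := g
      map_one' := hιinj (by rw [hg, map_one]; rfl)
      map_mul' := fun x y => hιinj (by rw [map_mul, hg, hg, hg]; rfl)
      map_zero' := hιinj (by rw [hg, map_zero]; rfl)
      map_add' := fun x y => hιinj (by rw [map_add, hg, hg, hg]; rfl) }
  have hφ : ι.comp φ = R.subtype := RingHom.ext hg
  have hVnorm : ∀ f, ι f ∈ normalizationSet R := fun f => by
    rw [hnorm]
    exact ⟨f, rfl⟩
  let _ : Algebra R (PowerSeries k) := φ.toAlgebra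
  have hφinj : Function.Injective (algebraMap R (PowerSeries k)) := fun x y hxy =>
    Subtype.ext (by rw [← hg x, ← hg y]; exact congrArg ι hxy)
  have : FaithfulSMul R (PowerSeries k) := (faithfulSMul_iff_algebraMap_injective _ _).mpr hφinj
  have : Algebra.IsIntegral R (PowerSeries k) := ⟨fun f => by
    obtain ⟨P, hP, hPf⟩ := (hVnorm f).2
    refine ⟨P, hP, hιinj ?_⟩
    rw [Polynomial.hom_eval₂, map_zero, ← hPf]
    exact congrArg (fun ψ => Polynomial.eval₂ ψ (ι f) P) hφ⟩
  have hk : ∀ a : k, PowerSeries.C a ∈ (algebraMap R (PowerSeries k)).range := by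
    intro a
    refine ⟨⟨algebraMap k (LaurentSeries k) a, hkR ⟨a, rfl⟩⟩, hιinj ?_⟩
    refine (hg _).trans ?_
    rw [hι, HahnSeries.ofPowerSeries_C]
    exact LaurentSeries.algebraMap_apply k a
  have hfrac : ∀ v : PowerSeries k, ∃ b : R, b ≠ 0 ∧
      algebraMap R (PowerSeries k) b * v ∈ (algebraMap R (PowerSeries k)).range := by
    intro v
    obtain ⟨a, ha, b, hb, hb0, hv⟩ := (hVnorm v).1
    refine ⟨⟨b, hb⟩, fun h => hb0 (congrArg Subtype.val h), ⟨a, ha⟩, hιinj ?_⟩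
    rw [map_mul]
    change ι (g _) = ι (g _) * ι v
    rw [hg, hg, hv, mul_div_cancel₀ _ hb0]
  obtain ⟨t, ht, ht0⟩ : ∃ t ∈ maximalIdeal R, t ≠ 0 := by
    refine Submodule.exists_mem_ne_zero_of_ne_bot fun hbot => ?_
    exact PowerSeries.not_isField (A := k) (isField_of_isIntegral_of_isField'
      (IsLocalRing.isField_iff_maximalIdeal_eq.mpr hbot))
  obtain ⟨b, hb, hbV⟩ := PowerSeries.exists_conductor_ne_zero p hk hfrac ht ht0
  exact PowerSeries.not_isAnalyticallyRamified_of_conductor_ne_zero hb hbV ht ht0 hram
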